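/- There exists a real polynomial P₆ of degree at most 5 with leading coefficient 1/120 such that for all real x ≥ e^{93}: |T₆(x) − x·P₆(log x)| < 1576.988 · x^{5/6} · (log x)^{5/3}. -/

import Mathlib

open Finset Real

/-- `dk k n` is the number of ways to write `n` as an ordered product of `k`
positive integers (the `k`-fold Dirichlet convolution of the constant
function `1`). -/
noncomputable def dk (k n : ℕ) : ℕ := (ArithmeticFunction.zeta ^ k) n

/-- `Tk k x = ∑_{n ≤ x} d_k(n)`. -/
noncomputable def Tk (k : ℕ) (x : ℝ) : ℝ := ∑ n ∈ Finset.Icc 1 ⌊x⌋₊, (dk k n : ℝ)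

lemma Tk_succ (k : ℕ) (x : ℝ) :
    Tk (k + 1) x = ∑ n ∈ Icc 1 ⌊x⌋₊, (dk k n : ℝ) * (⌊x / n⌋₊ : ℝ) := by
  have h := ArithmeticFunction.sum_Ioc_mul_zeta_eq_sum (R := ℕ) (ArithmeticFunction.zeta ^ k) ⌊x⌋₊
  unfold Tk dk
  rw [pow_succ]
  have h2 : ∀ N : ℕ, Icc 1 N = Ioc 0 N := fun N => rfl
  simp only [h2]
  have h3 := congrArg (Nat.cast (R := ℝ)) h
  push_cast at h3
  simp only [ArithmeticFunction.natCoe_nat, Nat.floor_div_natCast] at h3 ⊢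
  rw [h3]

/-- Sums of `Tk k (x / m)` over `m ≤ M`, where `M = x / N`, complement the terms `n ≤ N`
(Dirichlet's hyperbola method). -/
lemma Tk_succ_hyperbola (k : ℕ) {x N : ℝ} (hN : 1 ≤ N) (hx : N ≤ x) :
    Tk (k + 1) x = ∑ m ∈ Icc 1 ⌊x / N⌋₊, Tk k (x / m) +
      ∑ n ∈ Icc 1 ⌊N⌋₊, (dk k n : ℝ) * ((⌊x / n⌋₊ : ℝ) - (⌊x / N⌋₊ : ℝ)) := by
  have hx0 : 0 < x := by linarith
  have hN0 : 0 < N := by linarith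
  have h1 : ∑ m ∈ Icc 1 ⌊x / N⌋₊, Tk k (x / m) =
      ∑ n ∈ Icc 1 ⌊x⌋₊, (dk k n : ℝ) * (min ⌊x / n⌋₊ ⌊x / N⌋₊ : ℕ) := by
    have h2 : ∀ m ∈ Icc 1 ⌊x / N⌋₊, Tk k (x / m) =
        ∑ n ∈ Icc 1 ⌊x⌋₊, if (m ≤ ⌊x / n⌋₊) then (dk k n : ℝ) else 0 := by
      intro m hm
      rw [← sum_filter]
      unfold Tk
      apply sum_congr _ (fun _ _ => rfl)
      ext n
      have hm1 : 1 ≤ m := (mem_Icc.1 hm).1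
      have hm0 : (0 : ℝ) < m := by exact_mod_cast hm1
      simp only [mem_Icc, mem_filter]
      constructor
      · rintro ⟨h1, h2⟩
        have hn0 : (0 : ℝ) < n := by exact_mod_cast h1
        have h3 := (Nat.le_floor_iff (by positivity)).1 h2
        rw [le_div_iff₀ hm0] at h3
        refine ⟨⟨h1, Nat.le_floor ?_⟩, Nat.le_floor ?_⟩
        · have : (1 : ℝ) ≤ m := by exact_mod_cast hm1
          nlinarith
        · rw [le_div_iff₀ hn0]; linarith
      · rintro ⟨⟨h1, _⟩, h2⟩
        have hn0 : (0 : ℝ) < n := by exact_mod_cast h1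
        have h3 := (Nat.le_floor_iff (by positivity)).1 h2
        rw [le_div_iff₀ hn0] at h3
        refine ⟨h1, Nat.le_floor ?_⟩
        rw [le_div_iff₀ hm0]; linarith
    rw [sum_congr rfl h2, sum_comm]
    apply sum_congr rfl
    intro n _
    rw [← sum_filter, sum_const]
    have : (Icc 1 ⌊x / N⌋₊).filter (fun m => m ≤ ⌊x / n⌋₊) = Icc 1 (min ⌊x / n⌋₊ ⌊x / N⌋₊) := by
      ext m; simp only [mem_filter, mem_Icc]; omega
    rw [this, Nat.card_Icc, nsmul_eq_mul, mul_comm]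
    simp
  have h4 : Icc 1 ⌊N⌋₊ ⊆ Icc 1 ⌊x⌋₊ := Icc_subset_Icc_right (Nat.floor_le_floor hx)
  rw [Tk_succ, h1, ← sub_eq_iff_eq_add', ← sum_sub_distrib]
  symm
  apply sum_subset_zero_on_sdiff h4
  · intro n hn
    rw [mem_sdiff, mem_Icc, mem_Icc] at hn
    have h5 : N < n := by
      apply Nat.lt_of_floor_lt; omega
    have h6 : x / n ≤ x / N := by gcongr
    rw [min_eq_left (Nat.floor_le_floor h6)]; ring
  · intro n hn
    rw [mem_Icc] at hn
    have hn0 : (0 : ℝ) < n := by exact_mod_cast hn.1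
    have h5 : (n : ℝ) ≤ N := (Nat.le_floor_iff (by positivity)).1 hn.2
    have h6 : x / N ≤ x / n := by gcongr
    rw [min_eq_right (Nat.floor_le_floor h6)]; ring

lemma Tk_mono (k : ℕ) : Monotone (Tk k) := fun x y h => by
  unfold Tk
  exact sum_le_sum_of_subset_of_nonneg (Icc_subset_Icc_right (Nat.floor_le_floor h))
    (fun _ _ _ => by positivity)

lemma Tk_one (x : ℝ) : Tk 1 x = ⌊x⌋₊ := by
  unfold Tk dk
  rw [pow_one]
  have : ∀ n ∈ Icc 1 ⌊x⌋₊, ((ArithmeticFunction.zeta n : ℕ) : ℝ) = 1 := by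
    intro n hn
    rw [ArithmeticFunction.zeta_apply_ne (by have := (mem_Icc.1 hn).1; omega)]; simp
  rw [sum_congr rfl this]; simp

/-- The polynomial `∑ j < k, a j * y ^ j / j!`. -/
noncomputable def logPoly (k : ℕ) (a : ℕ → ℝ) (y : ℝ) : ℝ :=
  ∑ j ∈ range k, a j * (y ^ j / j.factorial)

/-- The tail sums `∑ j ≤ i < k, b i`. -/
noncomputable def tailSum (k : ℕ) (b : ℕ → ℝ) (j : ℕ) : ℝ := ∑ i ∈ Ico j k, b i

/-- The coefficients of the primitive of `logPoly k a`. -/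
noncomputable def shiftUp (a : ℕ → ℝ) : ℕ → ℝ
  | 0 => 0
  | j + 1 => a j

lemma logPoly_succ_of_eq_zero {k : ℕ} {a : ℕ → ℝ} (ha : a k = 0) (y : ℝ) :
    logPoly (k + 1) a y = logPoly k a y := by
  simp [logPoly, sum_range_succ, ha]

lemma logPoly_add (k : ℕ) (a b : ℕ → ℝ) (y : ℝ) :
    logPoly k (fun j => a j + b j) y = logPoly k a y + logPoly k b y := by
  simp [logPoly, add_mul, sum_add_distrib]

lemma logPoly_sub (k : ℕ) (a b : ℕ → ℝ) (y : ℝ) :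
    logPoly k (fun j => a j - b j) y = logPoly k a y - logPoly k b y := by
  simp [logPoly, sub_mul, sum_sub_distrib]

lemma logPoly_zero_right {k : ℕ} (hk : k ≠ 0) (a : ℕ → ℝ) : logPoly k a 0 = a 0 := by
  obtain ⟨m, rfl⟩ := Nat.exists_eq_succ_of_ne_zero hk
  simp [logPoly, sum_range_succ']

lemma continuous_logPoly (k : ℕ) (a : ℕ → ℝ) : Continuous (logPoly k a) := by
  unfold logPoly; fun_prop

lemma hasDerivAt_logPoly {k : ℕ} {a : ℕ → ℝ} (ha : a k = 0) (y : ℝ) :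
    HasDerivAt (logPoly k a) (logPoly k (fun j => a (j + 1)) y) y := by
  have h : HasDerivAt (logPoly k a)
      (∑ j ∈ range k, a j * ((j : ℝ) * y ^ (j - 1) / j.factorial)) y := by
    unfold logPoly
    apply HasDerivAt.fun_sum
    intro j _
    exact ((hasDerivAt_pow j y).div_const _).const_mul _
  convert h using 1
  cases k with
  | zero => simp [logPoly]
  | succ k =>
    rw [logPoly_succ_of_eq_zero (a := fun j => a (j + 1)) ha, sum_range_succ']
    simp only [Nat.cast_zero, zero_mul, zero_div, mul_zero, add_zero, logPoly]
    apply sum_congr rfl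
    intro j _
    rw [Nat.factorial_succ, Nat.add_sub_cancel]
    have : (j.factorial : ℝ) ≠ 0 := by positivity
    push_cast
    field_simp

lemma hasDerivAt_logPoly_shiftUp (k : ℕ) (a : ℕ → ℝ) (y : ℝ) :
    HasDerivAt (logPoly (k + 1) (shiftUp a)) (logPoly k a y) y := by
  have h : HasDerivAt (logPoly (k + 1) (shiftUp a))
      (∑ j ∈ range (k + 1), shiftUp a j * ((j : ℝ) * y ^ (j - 1) / j.factorial)) y := by
    unfold logPoly
    apply HasDerivAt.fun_sum
    intro j _
    exact ((hasDerivAt_pow j y).div_const _).const_mul _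
  convert h using 1
  rw [sum_range_succ']
  simp only [Nat.cast_zero, zero_mul, zero_div, mul_zero, add_zero, logPoly]
  apply sum_congr rfl
  intro j _
  rw [Nat.factorial_succ, Nat.add_sub_cancel]
  have : (j.factorial : ℝ) ≠ 0 := by positivity
  push_cast
  simp only [shiftUp]
  field_simp

lemma abs_logPoly_le {k : ℕ} {a b : ℕ → ℝ} (hab : ∀ j, |a j| ≤ b j) {y z : ℝ} (hyz : |y| ≤ z) :
    |logPoly k a y| ≤ logPoly k b z := by
  unfold logPoly
  refine (abs_sum_le_sum_abs _ _).trans (sum_le_sum fun j _ => ?_)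
  rw [abs_mul, abs_div, abs_pow, Nat.abs_cast]
  have := hab j
  have h0 := abs_nonneg (a j)
  gcongr
  exact h0.trans this

lemma logPoly_nonneg {k : ℕ} {b : ℕ → ℝ} (hb : ∀ j, 0 ≤ b j) {y : ℝ} (hy : 0 ≤ y) :
    0 ≤ logPoly k b y := by
  unfold logPoly
  exact sum_nonneg fun j _ => mul_nonneg (hb j) (by positivity)

lemma logPoly_sub_arg {k : ℕ} {q : ℕ → ℝ} (hq : ∀ j, k ≤ j → q j = 0) (L y : ℝ) :
    logPoly k q (L - y) = ∑ j ∈ range k, logPoly k (fun i => q (i + j)) (-y) *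
      (L ^ j / j.factorial) := by
  have h1 : ∀ n ∈ range k, q n * ((L - y) ^ n / n.factorial) =
      ∑ j ∈ range (n + 1), q (n - j + j) * ((-y) ^ (n - j) / (n - j).factorial) *
        (L ^ j / j.factorial) := by
    intro n _
    rw [sub_eq_add_neg, add_pow, sum_div, mul_sum]
    apply sum_congr rfl
    intro j hj
    have hj' : j ≤ n := by simpa [Nat.lt_succ_iff] using hj
    rw [Nat.sub_add_cancel hj', Nat.choose_eq_factorial_div_factorial hj',
      Nat.cast_div (Nat.factorial_mul_factorial_dvd_factorial hj') (by positivity)]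
    have h1 : (j.factorial : ℝ) ≠ 0 := by positivity
    have h2 : (n.factorial : ℝ) ≠ 0 := by positivity
    have h3 : ((n - j).factorial : ℝ) ≠ 0 := by positivity
    push_cast
    field_simp
  unfold logPoly
  rw [sum_congr rfl h1]
  rw [sum_range_diag_flip k (fun j i => q (i + j) * ((-y) ^ i / i.factorial) *
        (L ^ j / j.factorial))]
  apply sum_congr rfl
  intro j hj
  rw [sum_mul]
  apply sum_subset (range_subset_range.2 (Nat.sub_le _ _))
  intro i _ hi
  rw [hq (i + j) (by simp at hi; omega)]
  simp

lemma tailSum_nonneg {k : ℕ} {b : ℕ → ℝ} (hb : ∀ j, 0 ≤ b j) (j : ℕ) : 0 ≤ tailSum k b j :=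
  sum_nonneg fun i _ => hb i

lemma tailSum_of_le {k : ℕ} (b : ℕ → ℝ) {j : ℕ} (hj : k ≤ j) : tailSum k b j = 0 := by
  simp [tailSum, hj]

lemma tailSum_sub_tailSum_succ {k : ℕ} {b : ℕ → ℝ} (hb : ∀ j, k ≤ j → b j = 0) (j : ℕ) :
    tailSum k b j - tailSum k b (j + 1) = b j := by
  by_cases hj : j < k
  · simp [tailSum, sum_eq_sum_Ico_succ_bot hj]
  · rw [tailSum_of_le b (by omega), tailSum_of_le b (by omega), hb j (by omega)]; simp

lemma tendsto_logPoly_div {k : ℕ} (a : ℕ → ℝ) {M : ℝ} (hM : 0 < M) (l : ℝ) :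
    Filter.Tendsto (fun t => -(logPoly k a (l + Real.log (t / M)) / t)) Filter.atTop (nhds 0) := by
  have h1 : ∀ j : ℕ, Filter.Tendsto (fun t => (l + Real.log (t / M)) ^ j / t) Filter.atTop
      (nhds 0) := by
    intro j
    have h2 := (Real.isLittleO_pow_log_id_atTop (n := j)).tendsto_div_nhds_zero
    have hc : 0 < Real.exp l / M := by positivity
    have h3 := (h2.comp (Filter.tendsto_id.const_mul_atTop hc)).const_mul (Real.exp l / M)
    rw [mul_zero] at h3
    refine h3.congr' ?_
    filter_upwards [Filter.eventually_gt_atTop 0] with t ht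
    simp only [Function.comp, id]
    have : Real.log (Real.exp l / M * t) = l + Real.log (t / M) := by
      rw [show Real.exp l / M * t = Real.exp l * (t / M) by ring,
        Real.log_mul (by positivity) (by positivity), Real.log_exp]
    rw [this]
    field_simp
  have h2 : Filter.Tendsto (fun t => -∑ j ∈ range k, a j / j.factorial *
      ((l + Real.log (t / M)) ^ j / t)) Filter.atTop
      (nhds (-∑ j ∈ range k, a j / j.factorial * 0)) :=
    (tendsto_finsetSum _ fun j _ => (h1 j).const_mul _).neg
  simp only [mul_zero, sum_const_zero, neg_zero] at h2
  refine h2.congr fun t => ?_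
  unfold logPoly
  rw [sum_div]
  congr 1
  apply sum_congr rfl
  intro j _
  ring

lemma integral_logPoly_div_sq {k : ℕ} {b : ℕ → ℝ} (hb : ∀ j, 0 ≤ b j) (hbk : ∀ j, k ≤ j → b j = 0)
    {M l : ℝ} (hM : 0 < M) (hl : 0 ≤ l) :
    MeasureTheory.IntegrableOn (fun t => logPoly k b (l + Real.log (t / M)) / t ^ 2) (Set.Ioi M) ∧
    ∫ t in Set.Ioi M, logPoly k b (l + Real.log (t / M)) / t ^ 2 =
      logPoly k (tailSum k b) l / M := by
  have hd : ∀ t ∈ Set.Ici M, HasDerivAt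
      (fun t => -(logPoly k (tailSum k b) (l + Real.log (t / M)) / t))
      (logPoly k b (l + Real.log (t / M)) / t ^ 2) t := by
    intro t ht
    have ht0 : 0 < t := hM.trans_le ht
    have h1 : HasDerivAt (fun t => l + Real.log (t / M)) (1 / t) t := by
      have := (((hasDerivAt_id t).div_const M).log (by positivity)).const_add l
      exact this.congr_deriv (by simp only [id]; field_simp)
    have h2 := (hasDerivAt_logPoly (k := k) (tailSum_of_le b le_rfl)
      (l + Real.log (t / M))).comp t h1
    have h3 := (h2.div (hasDerivAt_id t) ht0.ne').neg
    refine h3.congr_deriv ?_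
    have h4 : logPoly k b (l + Real.log (t / M)) = logPoly k (tailSum k b) (l + Real.log (t / M)) -
        logPoly k (fun j => tailSum k b (j + 1)) (l + Real.log (t / M)) := by
      rw [← logPoly_sub]
      simp only [tailSum_sub_tailSum_succ hbk]
    rw [h4]
    simp only [id, Function.comp]
    field_simp
    ring
  have hpos : ∀ t ∈ Set.Ioi M, 0 ≤ logPoly k b (l + Real.log (t / M)) / t ^ 2 := by
    intro t ht
    have h1 : 1 ≤ t / M := by rw [one_le_div hM]; exact (Set.mem_Ioi.1 ht).le
    have := Real.log_nonneg h1
    exact div_nonneg (logPoly_nonneg hb (by linarith)) (by positivity)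
  have h_integrable := MeasureTheory.integrableOn_Ioi_deriv_of_nonneg' hd hpos
    (tendsto_logPoly_div (k := k) (tailSum k b) hM l)
  refine ⟨h_integrable, ?_⟩
  rw [MeasureTheory.integral_Ioi_of_hasDerivAt_of_tendsto' hd h_integrable
    (tendsto_logPoly_div (k := k) (tailSum k b) hM l)]
  simp [hM.ne']

lemma sum_Icc_one_mul_eq (c : ℕ → ℝ) {f f' : ℝ → ℝ} (b : ℝ)
    (hf : ∀ t ∈ Set.Icc 1 b, HasDerivAt f (f' t) t) (hf' : ContinuousOn f' (Set.Icc 1 b)) :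
    ∑ n ∈ Icc 1 ⌊b⌋₊, f n * c n = f b * ∑ n ∈ Icc 1 ⌊b⌋₊, c n -
      ∫ t in Set.Ioc 1 b, f' t * ∑ n ∈ Icc 1 ⌊t⌋₊, c n := by
  have hderiv : Set.EqOn (deriv f) f' (Set.Icc 1 b) := fun t ht => (hf t ht).deriv
  have hsum : ∀ (g : ℕ → ℝ) (m : ℕ), g 0 = 0 → ∑ n ∈ Icc 0 m, g n = ∑ n ∈ Icc 1 m, g n := by
    intro g m hg
    rw [Icc_eq_cons_Ioc (Nat.zero_le _), sum_cons, hg, zero_add]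
    rfl
  have hc : ∀ m : ℕ, ∑ n ∈ Icc 0 m, (if n = 0 then 0 else c n) = ∑ n ∈ Icc 1 m, c n := by
    intro m
    rw [hsum _ _ (by simp)]
    refine sum_congr rfl fun n hn => ?_
    rw [if_neg (by have := (mem_Icc.1 hn).1; omega)]
  have h := sum_mul_eq_sub_integral_mul₀ (fun n => if n = 0 then 0 else c n) (f := f)
    (by simp) b (fun t ht => (hf t ht).differentiableAt)
    ((hf'.integrableOn_compact isCompact_Icc).congr_fun hderiv.symm measurableSet_Icc)
  simp only [hc] at h
  rw [hsum _ _ (by simp)] at h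
  have h2 : ∑ n ∈ Icc 1 ⌊b⌋₊, f n * c n =
      ∑ n ∈ Icc 1 ⌊b⌋₊, f n * (if n = 0 then 0 else c n) := by
    refine sum_congr rfl fun n hn => ?_
    rw [if_neg (by have := (mem_Icc.1 hn).1; omega)]
  rw [h2, h]
  congr 1
  refine MeasureTheory.setIntegral_congr_fun measurableSet_Ioc fun t ht => ?_
  simp only [hderiv (Set.Ioc_subset_Icc_self ht)]

lemma natCast_floor_eq_sub_fract {t : ℝ} (ht : 0 ≤ t) : (⌊t⌋₊ : ℝ) = t - Int.fract t := by
  rw [natCast_floor_eq_intCast_floor ht, Int.self_sub_fract]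

lemma integral_fract_mul_logPoly {k : ℕ} {q b : ℕ → ℝ} (hqb : ∀ j, |q j| ≤ b j)
    (hbk : ∀ j, k ≤ j → b j = 0) {M l : ℝ} (hM : 0 < M) (hl : 0 ≤ l) :
    MeasureTheory.IntegrableOn (fun t => Int.fract t * logPoly k q (l - Real.log (t / M)) / t ^ 2)
      (Set.Ioi M) ∧
    |∫ t in Set.Ioi M, Int.fract t * logPoly k q (l - Real.log (t / M)) / t ^ 2| ≤
      logPoly k (tailSum k b) l / M := by
  obtain ⟨h1, h2⟩ := integral_logPoly_div_sq (fun j => (abs_nonneg _).trans (hqb j)) hbk hM hl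
  have hle : ∀ t ∈ Set.Ioi M, ‖Int.fract t * logPoly k q (l - Real.log (t / M)) / t ^ 2‖ ≤
      logPoly k b (l + Real.log (t / M)) / t ^ 2 := by
    intro t ht
    have ht0 : 0 < t := hM.trans ht
    have hlog : 0 ≤ Real.log (t / M) :=
      Real.log_nonneg (by rw [one_le_div hM]; exact (Set.mem_Ioi.1 ht).le)
    have h3 : |logPoly k q (l - Real.log (t / M))| ≤ logPoly k b (l + Real.log (t / M)) :=
      abs_logPoly_le hqb (abs_le.2 ⟨by linarith, by linarith⟩)
    rw [Real.norm_eq_abs, abs_div, abs_mul, Int.abs_fract, abs_of_pos (pow_pos ht0 2)]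
    gcongr
    calc _ ≤ 1 * |logPoly k q (l - Real.log (t / M))| := by
          gcongr; exact (Int.fract_lt_one t).le
      _ ≤ _ := by rwa [one_mul]
  have hmeas : Measurable
      (fun t : ℝ => Int.fract t * logPoly k q (l - Real.log (t / M)) / t ^ 2) := by
    have := (continuous_logPoly k q).measurable
    have h4 : Measurable fun t : ℝ => logPoly k q (l - Real.log (t / M)) := by fun_prop
    exact (measurable_fract.mul h4).div (by fun_prop)
  have hae := (MeasureTheory.ae_restrict_iff' (μ := MeasureTheory.volume)
    (measurableSet_Ioi (a := M))).2 (Filter.Eventually.of_forall hle)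
  refine ⟨h1.mono' hmeas.aestronglyMeasurable hae, ?_⟩
  rw [← h2, ← Real.norm_eq_abs]
  exact MeasureTheory.norm_integral_le_of_norm_le h1 hae

/-- The error term in the approximation of `Tk k x` by `x * logPoly k a (log x)`. -/
noncomputable def remainder (k : ℕ) (a : ℕ → ℝ) (x : ℝ) : ℝ :=
  Tk k x - x * logPoly k a (Real.log x)

/-- The coefficients of the polynomial `∫ t in 1..∞, fract t * logPoly k q (y - log t) / t ^ 2`. -/
noncomputable def fractCoeff (k : ℕ) (q : ℕ → ℝ) (j : ℕ) : ℝ :=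
  ∫ t in Set.Ioi 1, Int.fract t * logPoly k (fun i => q (i + j)) (-Real.log t) / t ^ 2

/-- The coefficients of the main term of `Tk (k + 1)` in terms of those of `Tk k`. -/
noncomputable def nextCoeff (k : ℕ) (a : ℕ → ℝ) (j : ℕ) : ℝ :=
  a j + shiftUp a j - fractCoeff k (fun i => a i + a (i + 1)) j +
    if j = 0 then ∫ u in Set.Ioi 1, remainder k a u / u ^ 2 else 0

lemma abs_fractCoeff_le {k : ℕ} {q b : ℕ → ℝ} (hqb : ∀ j, |q j| ≤ b j)
    (hbk : ∀ j, k ≤ j → b j = 0) (j : ℕ) : |fractCoeff k q j| ≤ tailSum k b j := by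
  rcases Nat.eq_zero_or_pos k with rfl | hk
  · simp [fractCoeff, logPoly, tailSum]
  have h := (integral_fract_mul_logPoly (k := k) (q := fun i => q (i + j))
    (b := fun i => b (i + j)) (fun i => hqb _) (fun i hi => hbk _ (by omega))
    zero_lt_one le_rfl).2
  simp only [div_one, zero_sub] at h
  rw [logPoly_zero_right hk.ne'] at h
  refine h.trans ?_
  unfold tailSum
  rw [sum_Ico_add' b 0 k j, zero_add]
  by_cases hj : j < k
  · rw [← sum_Ico_consecutive b hj.le (Nat.le_add_right k j), add_le_iff_nonpos_right]
    exact (sum_eq_zero fun i hi => hbk i (mem_Ico.1 hi).1).le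
  · rw [Ico_eq_empty_of_le (not_lt.1 hj), sum_empty]
    exact (sum_eq_zero fun i hi => hbk i (by have := (mem_Ico.1 hi).1; omega)).le

lemma fractCoeff_of_le {k : ℕ} {q : ℕ → ℝ} (hq : ∀ j, k ≤ j → q j = 0) {j : ℕ} (hj : k ≤ j) :
    fractCoeff k q j = 0 := by
  have h := abs_fractCoeff_le (k := k) (q := q) (b := fun j => |q j|) (fun j => le_rfl)
    (fun j hj => by simp [hq j hj]) j
  rw [tailSum_of_le _ hj] at h
  exact abs_eq_zero.1 (le_antisymm h (abs_nonneg _))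

lemma integral_fract_mul_logPoly_sub {k : ℕ} {q : ℕ → ℝ} (hq : ∀ j, k ≤ j → q j = 0) (L : ℝ) :
    ∫ t in Set.Ioi 1, Int.fract t * logPoly k q (L - Real.log t) / t ^ 2 =
      logPoly k (fractCoeff k q) L := by
  have h1 : ∀ t : ℝ, Int.fract t * logPoly k q (L - Real.log t) / t ^ 2 =
      ∑ j ∈ range k, (Int.fract t * logPoly k (fun i => q (i + j)) (-Real.log t) / t ^ 2) *
        (L ^ j / j.factorial) := by
    intro t
    rw [logPoly_sub_arg hq, mul_sum, sum_div]
    refine sum_congr rfl fun j _ => ?_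
    ring
  simp only [h1]
  rw [MeasureTheory.integral_finsetSum]
  · unfold logPoly fractCoeff
    refine sum_congr rfl fun j _ => ?_
    rw [MeasureTheory.integral_mul_const]
    rfl
  · intro j _
    apply MeasureTheory.Integrable.mul_const
    have h := (integral_fract_mul_logPoly (k := k) (q := fun i => q (i + j))
      (b := fun i => |q (i + j)|) (fun i => le_rfl) (fun i hi => by simp [hq (i + j) (by omega)])
      zero_lt_one le_rfl).1
    simp only [div_one, zero_sub] at h
    exact h

lemma sum_div_mul_logPoly {k : ℕ} {a : ℕ → ℝ} (ha : ∀ j, k ≤ j → a j = 0) {x M : ℝ}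
    (hx : 1 ≤ x) (hM : 1 ≤ M) :
    ∑ m ∈ Icc 1 ⌊M⌋₊, x / m * logPoly k a (Real.log (x / m)) =
      x / M * logPoly k a (Real.log (x / M)) * (M - Int.fract M) +
      x * (logPoly k a (Real.log x) + logPoly (k + 1) (shiftUp a) (Real.log x) -
        logPoly k a (Real.log (x / M)) - logPoly (k + 1) (shiftUp a) (Real.log (x / M)) -
        logPoly k (fractCoeff k fun j => a j + a (j + 1)) (Real.log x) +
        ∫ t in Set.Ioi M, Int.fract t *
          logPoly k (fun j => a j + a (j + 1)) (Real.log (x / M) - Real.log (t / M)) / t ^ 2) := by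
  have hx0 : 0 < x := by linarith
  have hM0 : 0 < M := by linarith
  set q : ℕ → ℝ := fun j => a j + a (j + 1) with hq
  have hqk : ∀ j, k ≤ j → q j = 0 := fun j hj => by
    simp [hq, ha j hj, ha (j + 1) (by omega)]
  have hQ : ∀ y, logPoly k q y = logPoly k a y + logPoly k (fun j => a (j + 1)) y :=
    fun y => logPoly_add _ _ _ _
  have hlog : ∀ t : ℝ, 0 < t → HasDerivAt (fun t => Real.log x - Real.log t) (-(1 / t)) t :=
    fun t ht => ((Real.hasDerivAt_log ht.ne').const_sub _).congr_deriv (by simp)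
  have hf : ∀ t ∈ Set.Icc 1 M, HasDerivAt
      (fun t => x / t * logPoly k a (Real.log x - Real.log t))
      (-(x * (logPoly k q (Real.log x - Real.log t) / t ^ 2))) t := by
    intro t ht
    have ht0 : 0 < t := by linarith [ht.1]
    have h1 := (hasDerivAt_logPoly (ha k le_rfl) (Real.log x - Real.log t)).comp t (hlog t ht0)
    have h2 := ((hasDerivAt_const t x).div (hasDerivAt_id t) ht0.ne').mul h1
    refine h2.congr_deriv ?_
    simp only [id, Function.comp, hQ, Pi.div_apply]
    field_simp
    ring
  have hcQ := continuous_logPoly k q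
  have hcont : ContinuousOn (fun t => logPoly k q (Real.log x - Real.log t)) (Set.Icc 1 M) := by
    apply hcQ.comp_continuousOn
    apply continuousOn_const.sub
    exact Real.continuousOn_log.mono fun t ht => by
      have := ht.1
      simp only [Set.mem_compl_iff, Set.mem_singleton_iff]
      intro h; rw [h] at this; linarith
  have hpow : ∀ t ∈ Set.Icc 1 M, t ^ 2 ≠ 0 := fun t ht => by
    have := ht.1
    positivity
  have hf' : ContinuousOn (fun t => -(x * (logPoly k q (Real.log x - Real.log t) / t ^ 2)))
      (Set.Icc 1 M) :=
    (continuousOn_const.mul (hcont.div (by fun_prop) hpow)).neg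
  have habel := sum_Icc_one_mul_eq (fun _ => 1) M hf hf'
  simp only [mul_one, sum_const, Nat.card_Icc, Nat.add_sub_cancel, nsmul_eq_mul] at habel
  have hleft : ∑ m ∈ Icc 1 ⌊M⌋₊, x / m * logPoly k a (Real.log (x / m)) =
      ∑ m ∈ Icc 1 ⌊M⌋₊, x / m * logPoly k a (Real.log x - Real.log m) := by
    refine sum_congr rfl fun m hm => ?_
    have : (m : ℝ) ≠ 0 := by have := (mem_Icc.1 hm).1; positivity
    rw [Real.log_div hx0.ne' this]
  have h_integrable := (integral_fract_mul_logPoly (k := k) (q := q) (b := fun j => |q j|)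
    (fun j => le_rfl) (fun j hj => by simp [hqk j hj]) zero_lt_one (Real.log_nonneg hx)).1
  simp only [div_one] at h_integrable
  have hprim : ∫ t in Set.Ioc 1 M, logPoly k q (Real.log x - Real.log t) / t =
      logPoly k a (Real.log x) + logPoly (k + 1) (shiftUp a) (Real.log x) -
        logPoly k a (Real.log (x / M)) - logPoly (k + 1) (shiftUp a) (Real.log (x / M)) := by
    rw [← intervalIntegral.integral_of_le hM,
      intervalIntegral.integral_eq_sub_of_hasDerivAt (f := fun t =>
        -(logPoly k a (Real.log x - Real.log t) +
          logPoly (k + 1) (shiftUp a) (Real.log x - Real.log t)))]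
    · rw [Real.log_div hx0.ne' hM0.ne']
      simp only [Real.log_one, sub_zero]
      ring
    · intro t ht
      rw [Set.uIcc_of_le hM] at ht
      have ht0 : 0 < t := by linarith [ht.1]
      have h1 := (hasDerivAt_logPoly (ha k le_rfl) (Real.log x - Real.log t)).comp t (hlog t ht0)
      have h2 := (hasDerivAt_logPoly_shiftUp k a (Real.log x - Real.log t)).comp t (hlog t ht0)
      refine (h1.add h2).neg.congr_deriv ?_
      rw [hQ]
      field_simp
      ring
    · apply ContinuousOn.intervalIntegrable
      rw [Set.uIcc_of_le hM]
      exact hcont.div continuousOn_id fun t ht => by have := ht.1; positivity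
  have hsplit : ∫ t in Set.Ioc 1 M, -(x * (logPoly k q (Real.log x - Real.log t) / t ^ 2)) *
      (⌊t⌋₊ : ℝ) = -x * (∫ t in Set.Ioc 1 M, logPoly k q (Real.log x - Real.log t) / t) +
        x * ∫ t in Set.Ioc 1 M, Int.fract t * logPoly k q (Real.log x - Real.log t) / t ^ 2 := by
    rw [← MeasureTheory.integral_const_mul, ← MeasureTheory.integral_const_mul,
      ← MeasureTheory.integral_add]
    · refine MeasureTheory.setIntegral_congr_fun measurableSet_Ioc fun t ht => ?_
      have ht0 : 0 < t := by linarith [ht.1]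
      simp only [natCast_floor_eq_sub_fract ht0.le]
      field_simp
      ring
    · apply MeasureTheory.Integrable.const_mul
      refine MeasureTheory.IntegrableOn.mono_set (t := Set.Icc 1 M) ?_ Set.Ioc_subset_Icc_self
      refine ContinuousOn.integrableOn_compact isCompact_Icc ?_
      exact hcont.div continuousOn_id fun t ht => by have := ht.1; positivity
    · apply MeasureTheory.Integrable.const_mul
      exact h_integrable.mono_set Set.Ioc_subset_Ioi_self
  have hunion : (∫ t in Set.Ioc 1 M, Int.fract t * logPoly k q (Real.log x - Real.log t) / t ^ 2) +
      (∫ t in Set.Ioi M, Int.fract t * logPoly k q (Real.log x - Real.log t) / t ^ 2) =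
      logPoly k (fractCoeff k q) (Real.log x) := by
    rw [← integral_fract_mul_logPoly_sub hqk, ← Set.Ioc_union_Ioi_eq_Ioi hM,
      MeasureTheory.setIntegral_union (Set.Ioc_disjoint_Ioi le_rfl) measurableSet_Ioi
        (h_integrable.mono_set Set.Ioc_subset_Ioi_self) (h_integrable.mono_set (Set.Ioi_subset_Ioi hM))]
  have htail : ∫ t in Set.Ioi M, Int.fract t *
      logPoly k q (Real.log (x / M) - Real.log (t / M)) / t ^ 2 =
      ∫ t in Set.Ioi M, Int.fract t * logPoly k q (Real.log x - Real.log t) / t ^ 2 := by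
    refine MeasureTheory.setIntegral_congr_fun measurableSet_Ioi fun t ht => ?_
    have ht0 : t ≠ 0 := (hM0.trans ht).ne'
    rw [Real.log_div hx0.ne' hM0.ne', Real.log_div ht0 hM0.ne', sub_sub_sub_cancel_right]
  rw [hleft, habel, hsplit, hprim, htail, ← Real.log_div hx0.ne' hM0.ne', ← hunion,
    natCast_floor_eq_sub_fract hM0.le]
  ring

lemma sum_dk_div {k : ℕ} (a : ℕ → ℝ)
    (h_integrable : MeasureTheory.IntegrableOn (fun u => remainder k a u / u ^ 2) (Set.Ioi 1))
    {N : ℝ} (hN : 1 ≤ N) :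
    ∑ n ∈ Icc 1 ⌊N⌋₊, (dk k n : ℝ) / n = Tk k N / N +
      logPoly (k + 1) (shiftUp a) (Real.log N) + (∫ u in Set.Ioi 1, remainder k a u / u ^ 2) -
      ∫ u in Set.Ioi N, remainder k a u / u ^ 2 := by
  have hf : ∀ t ∈ Set.Icc 1 N, HasDerivAt (fun t : ℝ => t⁻¹) (-(t ^ 2)⁻¹) t := fun t ht =>
    hasDerivAt_inv (by have := ht.1; positivity)
  have hf' : ContinuousOn (fun t : ℝ => -(t ^ 2)⁻¹) (Set.Icc 1 N) :=
    (ContinuousOn.inv₀ (by fun_prop) fun t ht => by have := ht.1; positivity).neg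
  have habel := sum_Icc_one_mul_eq (fun n => (dk k n : ℝ)) N hf hf'
  have hcont : ContinuousOn (fun t => logPoly k a (Real.log t) / t) (Set.Icc 1 N) := by
    refine ((continuous_logPoly k a).comp_continuousOn (Real.continuousOn_log.mono ?_)).div
      continuousOn_id fun t ht => by have := ht.1; positivity
    intro t ht h
    have := ht.1
    rw [Set.mem_singleton_iff.1 h] at this
    linarith
  have hprim : ∫ t in Set.Ioc 1 N, logPoly k a (Real.log t) / t =
      logPoly (k + 1) (shiftUp a) (Real.log N) := by
    rw [← intervalIntegral.integral_of_le hN,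
      intervalIntegral.integral_eq_sub_of_hasDerivAt (f := fun t =>
        logPoly (k + 1) (shiftUp a) (Real.log t))]
    · rw [Real.log_one, logPoly_zero_right (Nat.succ_ne_zero k)]
      simp [shiftUp]
    · intro t ht
      rw [Set.uIcc_of_le hN] at ht
      have ht0 : t ≠ 0 := by have := ht.1; positivity
      exact ((hasDerivAt_logPoly_shiftUp k a _).comp t (Real.hasDerivAt_log ht0)).congr_deriv
        (by field_simp)
    · apply ContinuousOn.intervalIntegrable
      rwa [Set.uIcc_of_le hN]
  have hsplit : ∫ t in Set.Ioc 1 N, -(t ^ 2)⁻¹ * ∑ n ∈ Icc 1 ⌊t⌋₊, (dk k n : ℝ) =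
      -((∫ t in Set.Ioc 1 N, logPoly k a (Real.log t) / t) +
        ∫ t in Set.Ioc 1 N, remainder k a t / t ^ 2) := by
    rw [← MeasureTheory.integral_add, ← MeasureTheory.integral_neg]
    · refine MeasureTheory.setIntegral_congr_fun measurableSet_Ioc fun t ht => ?_
      have ht0 : t ≠ 0 := by have := ht.1; positivity
      simp only [remainder, Tk]
      field_simp
      ring
    · exact (hcont.integrableOn_compact isCompact_Icc).mono_set Set.Ioc_subset_Icc_self
    · exact h_integrable.mono_set Set.Ioc_subset_Ioi_self
  have hunion : ∫ u in Set.Ioi 1, remainder k a u / u ^ 2 =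
      (∫ u in Set.Ioc 1 N, remainder k a u / u ^ 2) +
        ∫ u in Set.Ioi N, remainder k a u / u ^ 2 := by
    rw [← MeasureTheory.setIntegral_union (Set.Ioc_disjoint_Ioi le_rfl) measurableSet_Ioi
        (h_integrable.mono_set Set.Ioc_subset_Ioi_self) (h_integrable.mono_set (Set.Ioi_subset_Ioi hN)),
      Set.Ioc_union_Ioi_eq_Ioi hN]
  have hleft : ∑ n ∈ Icc 1 ⌊N⌋₊, (dk k n : ℝ) / n = ∑ n ∈ Icc 1 ⌊N⌋₊, (n : ℝ)⁻¹ * dk k n :=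
    sum_congr rfl fun n _ => by rw [div_eq_mul_inv, mul_comm]
  rw [hleft, habel, hsplit, hprim, hunion, Tk]
  ring

/-- The remainder of `Tk (k + 1)` expressed through that of `Tk k` by the hyperbola method. -/
lemma remainder_nextCoeff {k : ℕ} {a : ℕ → ℝ} (ha : ∀ j, k ≤ j → a j = 0)
    (h_integrable : MeasureTheory.IntegrableOn (fun u => remainder k a u / u ^ 2) (Set.Ioi 1))
    {x N : ℝ} (hN : 1 ≤ N) (hx : N ≤ x) :
    remainder (k + 1) (nextCoeff k a) x =
      ∑ m ∈ Icc 1 ⌊x / N⌋₊, remainder k a (x / m) + Int.fract (x / N) * remainder k a N -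
      ∑ n ∈ Icc 1 ⌊N⌋₊, (dk k n : ℝ) * Int.fract (x / n) +
      x * (∫ t in Set.Ioi (x / N), Int.fract t * logPoly k (fun j => a j + a (j + 1))
        (Real.log N - Real.log (t / (x / N))) / t ^ 2) -
      x * ∫ u in Set.Ioi N, remainder k a u / u ^ 2 := by
  have hx0 : 0 < x := by linarith
  have hN0 : 0 < N := by linarith
  have hM : 1 ≤ x / N := (one_le_div hN0).2 hx
  have hxM : x / (x / N) = N := by field_simp
  have h1 := sum_div_mul_logPoly (x := x) ha (by linarith) hM
  have h2 := sum_dk_div a h_integrable hN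
  have h3 : ∑ m ∈ Icc 1 ⌊x / N⌋₊, Tk k (x / m) = ∑ m ∈ Icc 1 ⌊x / N⌋₊, remainder k a (x / m) +
      ∑ m ∈ Icc 1 ⌊x / N⌋₊, x / m * logPoly k a (Real.log (x / m)) := by
    rw [← sum_add_distrib]
    exact sum_congr rfl fun m _ => by simp [remainder]
  have h4 : ∑ n ∈ Icc 1 ⌊N⌋₊, (dk k n : ℝ) * ((⌊x / n⌋₊ : ℝ) - (⌊x / N⌋₊ : ℝ)) =
      x * ∑ n ∈ Icc 1 ⌊N⌋₊, (dk k n : ℝ) / n -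
      ∑ n ∈ Icc 1 ⌊N⌋₊, (dk k n : ℝ) * Int.fract (x / n) -
      (x / N - Int.fract (x / N)) * Tk k N := by
    rw [Tk, mul_sum, mul_sum, ← sum_sub_distrib, ← sum_sub_distrib]
    refine sum_congr rfl fun n _ => ?_
    rw [natCast_floor_eq_sub_fract (by positivity), natCast_floor_eq_sub_fract (by positivity)]
    ring
  have h5 : logPoly (k + 1) (nextCoeff k a) (Real.log x) = logPoly k a (Real.log x) +
      logPoly (k + 1) (shiftUp a) (Real.log x) -
      logPoly k (fractCoeff k fun j => a j + a (j + 1)) (Real.log x) +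
      ∫ u in Set.Ioi 1, remainder k a u / u ^ 2 := by
    have hq : ∀ j, k ≤ j → (fun j => a j + a (j + 1)) j = 0 := fun j hj => by
      simp [ha j hj, ha (j + 1) (by omega)]
    rw [← logPoly_succ_of_eq_zero (ha k le_rfl),
      ← logPoly_succ_of_eq_zero (fractCoeff_of_le hq le_rfl)]
    have h6 : (∫ u in Set.Ioi 1, remainder k a u / u ^ 2) = logPoly (k + 1)
        (fun j => if j = 0 then ∫ u in Set.Ioi 1, remainder k a u / u ^ 2 else 0)
        (Real.log x) := by
      simp [logPoly]
    rw [h6, ← logPoly_add, ← logPoly_sub, ← logPoly_add]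
    rfl
  have h7 : Tk k N = remainder k a N + N * logPoly k a (Real.log N) := by simp [remainder]
  rw [hxM] at h1
  rw [remainder, Tk_succ_hyperbola k hN hx, h3, h4, h1, h2, h5, h7]
  field_simp
  ring

/-- The slowly varying factor in which powers of `log u` are measured. -/
noncomputable def logFactor (u : ℝ) : ℝ := 1 + Real.log u / 12

lemma one_le_logFactor {u : ℝ} (hu : 1 ≤ u) : 1 ≤ logFactor u := by
  have := Real.log_nonneg hu
  unfold logFactor
  linarith

lemma logFactor_mono {u v : ℝ} (hu : 1 ≤ u) (huv : u ≤ v) : logFactor u ≤ logFactor v := by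
  have := Real.log_le_log (by linarith) huv
  unfold logFactor
  linarith

lemma logFactor_le_mul_rpow {N u : ℝ} (hN : 1 ≤ N) (hu : N ≤ u) :
    logFactor u ≤ logFactor N * (u / N) ^ ((1 : ℝ) / 12) := by
  have hN0 : 0 < N := by linarith
  have hu0 : 0 < u := by linarith
  have h1 : 0 ≤ Real.log (u / N) := Real.log_nonneg ((one_le_div hN0).2 hu)
  have h2 := Real.log_nonneg hN
  have h3 : Real.log u = Real.log N + Real.log (u / N) := by
    rw [Real.log_div hu0.ne' hN0.ne']; ring
  have h4 : 1 + Real.log (u / N) / 12 ≤ (u / N) ^ ((1 : ℝ) / 12) := by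
    rw [Real.rpow_def_of_pos (by positivity)]
    have := Real.add_one_le_exp (Real.log (u / N) * (1 / 12))
    linarith
  have h5 := one_le_logFactor hN
  calc logFactor u ≤ logFactor N * (1 + Real.log (u / N) / 12) := by
        unfold logFactor; rw [h3]; nlinarith
    _ ≤ _ := by gcongr

lemma logFactor_le_rpow {x : ℝ} (hx : 1 ≤ x) : logFactor x ≤ x ^ ((1 : ℝ) / 12) := by
  have := logFactor_le_mul_rpow le_rfl hx
  simpa [logFactor] using this

lemma rpow_add_mul_sub_le_rpow {s : ℝ} (hs0 : 0 ≤ s) (hs1 : s ≤ 1) {n M : ℝ} (hn : 0 ≤ n)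
    (hM : 0 < M) : n ^ s + s * (M - n) * M ^ (s - 1) ≤ M ^ s := by
  have h := rpow_one_add_le_one_add_mul_self (s := n / M - 1)
    (by have : 0 ≤ n / M := by positivity
        linarith) hs0 hs1
  rw [add_sub_cancel, Real.div_rpow hn hM.le, div_le_iff₀ (by positivity)] at h
  rw [Real.rpow_sub_one hM.ne']
  calc _ ≤ (1 + s * (n / M - 1)) * M ^ s + s * (M - n) * (M ^ s / M) := by gcongr
    _ = M ^ s := by field_simp; ring

lemma sum_rpow_sub_one_le {s : ℝ} (hs0 : 0 < s) (hs1 : s ≤ 1) (n : ℕ) :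
    ∑ m ∈ Icc 1 n, (m : ℝ) ^ (s - 1) ≤ (n : ℝ) ^ s / s := by
  induction n with
  | zero => simp [hs0.ne']
  | succ n ih =>
    rw [sum_Icc_succ_top (by omega)]
    have h := rpow_add_mul_sub_le_rpow hs0.le hs1 (n := n) (M := (n + 1 : ℕ)) (by positivity)
      (by positivity)
    rw [le_div_iff₀ hs0] at ih ⊢
    push_cast at h ⊢
    linarith

lemma sum_rpow_sub_one_add_fract_le {s : ℝ} (hs0 : 0 < s) (hs1 : s ≤ 1) {M : ℝ} (hM : 0 < M) :
    ∑ m ∈ Icc 1 ⌊M⌋₊, (m : ℝ) ^ (s - 1) + Int.fract M * M ^ (s - 1) ≤ M ^ s / s := by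
  have h1 := sum_rpow_sub_one_le hs0 hs1 ⌊M⌋₊
  have h2 := rpow_add_mul_sub_le_rpow hs0.le hs1 (n := ⌊M⌋₊) (by positivity) hM
  have h3 : M - ⌊M⌋₊ = Int.fract M := by rw [natCast_floor_eq_sub_fract hM.le]; ring
  rw [h3] at h2
  rw [le_div_iff₀ hs0] at h1 ⊢
  linarith

lemma integral_remainder_bound {k : ℕ} {a : ℕ → ℝ} {C A s : ℝ} (hC : 0 ≤ C) (hA : 0 ≤ A)
    (hAs : A / 12 < s)
    (hrem : ∀ u, 1 ≤ u → |remainder k a u| ≤ C * u ^ (1 - s) * logFactor u ^ A)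
    {N : ℝ} (hN : 1 ≤ N) :
    MeasureTheory.IntegrableOn (fun u => remainder k a u / u ^ 2) (Set.Ioi N) ∧
    |∫ u in Set.Ioi N, remainder k a u / u ^ 2| ≤
      C / (s - A / 12) * N ^ (-s) * logFactor N ^ A := by
  have hN0 : 0 < N := by linarith
  have hlam := one_le_logFactor hN
  have hexp : -1 - s + A / 12 < -1 := by linarith
  have hle : ∀ u ∈ Set.Ioi N, ‖remainder k a u / u ^ 2‖ ≤
      C * logFactor N ^ A * N ^ (-(A / 12)) * u ^ (-1 - s + A / 12) := by
    intro u hu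
    have hNu : N ≤ u := (Set.mem_Ioi.1 hu).le
    have hu0 : 0 < u := by linarith
    have h1 := hrem u (hN.trans hNu)
    have h2 : logFactor u ^ A ≤ logFactor N ^ A * (u ^ (A / 12) * N ^ (-(A / 12))) := by
      calc logFactor u ^ A ≤ (logFactor N * (u / N) ^ ((1 : ℝ) / 12)) ^ A :=
            Real.rpow_le_rpow (by linarith [one_le_logFactor (hN.trans hNu)])
              (logFactor_le_mul_rpow hN hNu) hA
        _ = logFactor N ^ A * (u ^ (A / 12) * N ^ (-(A / 12))) := by
            rw [Real.mul_rpow (by linarith) (by positivity), ← Real.rpow_mul (by positivity),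
              Real.div_rpow hu0.le hN0.le, Real.rpow_neg hN0.le, one_div_mul_eq_div,
              div_eq_mul_inv]
    have h3 : u ^ (-1 - s + A / 12) = u ^ (1 - s) * u ^ (A / 12) / u ^ 2 := by
      rw [← Real.rpow_natCast, ← Real.rpow_add hu0, ← Real.rpow_sub hu0]
      congr 1
      push_cast
      ring
    rw [Real.norm_eq_abs, abs_div, abs_of_pos (pow_pos hu0 2), h3]
    calc _ ≤ C * u ^ (1 - s) * (logFactor N ^ A * (u ^ (A / 12) * N ^ (-(A / 12)))) / u ^ 2 := by
          gcongr
          exact h1.trans (by gcongr)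
      _ = _ := by ring
  have hdom : MeasureTheory.IntegrableOn
      (fun u : ℝ => C * logFactor N ^ A * N ^ (-(A / 12)) * u ^ (-1 - s + A / 12)) (Set.Ioi N) :=
    (integrableOn_Ioi_rpow_of_lt hexp hN0).const_mul _
  have hmeas : Measurable (fun u => remainder k a u / u ^ 2) := by
    have h1 := (Tk_mono k).measurable
    have h2 := (continuous_logPoly k a).measurable
    unfold remainder
    fun_prop
  have hae := (MeasureTheory.ae_restrict_iff' (μ := MeasureTheory.volume)
    (measurableSet_Ioi (a := N))).2 (Filter.Eventually.of_forall hle)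
  refine ⟨hdom.mono' hmeas.aestronglyMeasurable hae, ?_⟩
  rw [← Real.norm_eq_abs]
  refine (MeasureTheory.norm_integral_le_of_norm_le hdom hae).trans_eq ?_
  rw [MeasureTheory.integral_const_mul, integral_Ioi_rpow_of_lt hexp hN0]
  have h4 : N ^ (-s) = N ^ (-(A / 12)) * N ^ (-1 - s + A / 12 + 1) := by
    rw [← Real.rpow_add hN0]
    congr 1
    ring
  rw [h4]
  have h5 : s - A / 12 ≠ 0 := by linarith
  have h6 : -1 - s + A / 12 + 1 = -(s - A / 12) := by ring
  rw [h6, neg_div_neg_eq]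
  ring

/-- The weight of the terms of size `N` in the hyperbola method. -/
noncomputable def weight (k : ℕ) (b : ℕ → ℝ) (C A y : ℝ) : ℝ :=
  logPoly k b y + C * (1 + y / 12) ^ A + logPoly k (tailSum k fun j => b j + b (j + 1)) y

lemma abs_remainder_nextCoeff_le {k : ℕ} {a b : ℕ → ℝ} {C A s : ℝ}
    (hab : ∀ j, |a j| ≤ b j) (hbk : ∀ j, k ≤ j → b j = 0) (hC : 0 ≤ C) (hA : 0 ≤ A)
    (hs1 : s ≤ 1) (hAs : A / 12 < s)
    (hrem : ∀ u, 1 ≤ u → |remainder k a u| ≤ C * u ^ (1 - s) * logFactor u ^ A)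
    {x N : ℝ} (hN : 1 ≤ N) (hx : N ≤ x) :
    |remainder (k + 1) (nextCoeff k a) x| ≤
      C * (1 / s + 1 / (s - A / 12)) * (x * N ^ (-s) * logFactor x ^ A) +
        N * weight k b C A (Real.log N) := by
  have hx0 : 0 < x := by linarith
  have hN0 : 0 < N := by linarith
  have hs0 : 0 < s := by have : 0 ≤ A / 12 := by positivity
                         linarith
  have ha : ∀ j, k ≤ j → a j = 0 := fun j hj =>
    abs_nonpos_iff.1 ((hab j).trans (hbk j hj).le)
  have hlamN := one_le_logFactor hN
  have hlamNx := logFactor_mono hN hx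
  have h_integrable := (integral_remainder_bound hC hA hAs hrem le_rfl).1
  have hmono : ∀ u, 1 ≤ u → u ≤ x → |remainder k a u| ≤ C * logFactor x ^ A * u ^ (1 - s) := by
    intro u hu hux
    refine (hrem u hu).trans ?_
    have := Real.rpow_le_rpow (by linarith [one_le_logFactor hu]) (logFactor_mono hu hux) hA
    calc _ ≤ C * u ^ (1 - s) * logFactor x ^ A := by gcongr
      _ = _ := by ring
  have hscale : ∀ m : ℝ, 0 < m → (x / m) ^ (1 - s) = x ^ (1 - s) * m ^ (s - 1) := by
    intro m hm
    rw [Real.div_rpow hx0.le hm.le, div_eq_mul_inv, ← Real.rpow_neg hm.le, neg_sub]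
  have hlam0 : 0 ≤ logFactor x ^ A := Real.rpow_nonneg (by linarith) A
  have hM0 : 0 < x / N := by positivity
  have hxM : x / (x / N) = N := by field_simp
  have hsum : |∑ m ∈ Icc 1 ⌊x / N⌋₊, remainder k a (x / m) +
      Int.fract (x / N) * remainder k a N| ≤
      C * (1 / s) * (x * N ^ (-s) * logFactor x ^ A) := by
    have h1 : ∀ m ∈ Icc 1 ⌊x / N⌋₊, |remainder k a (x / m)| ≤
        C * logFactor x ^ A * (x ^ (1 - s) * (m : ℝ) ^ (s - 1)) := by
      intro m hm
      obtain ⟨hm1, hm2⟩ := mem_Icc.1 hm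
      have hm1' : (1 : ℝ) ≤ m := by exact_mod_cast hm1
      have hm0 : (0 : ℝ) < m := by linarith
      have hm3 : (m : ℝ) ≤ x / N := (Nat.le_floor_iff hM0.le).1 hm2
      rw [← hscale m hm0]
      apply hmono
      · rw [le_div_iff₀ hN0] at hm3
        rw [le_div_iff₀ hm0]
        nlinarith
      · exact div_le_self hx0.le hm1'
    have h2 : |remainder k a N| ≤
        C * logFactor x ^ A * (x ^ (1 - s) * (x / N) ^ (s - 1)) := by
      rw [← hscale _ hM0, hxM]
      exact hmono N hN hx
    calc _ ≤ |∑ m ∈ Icc 1 ⌊x / N⌋₊, remainder k a (x / m)| +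
          |Int.fract (x / N) * remainder k a N| := abs_add_le _ _
      _ ≤ ∑ m ∈ Icc 1 ⌊x / N⌋₊, C * logFactor x ^ A * (x ^ (1 - s) * (m : ℝ) ^ (s - 1)) +
          Int.fract (x / N) * (C * logFactor x ^ A * (x ^ (1 - s) * (x / N) ^ (s - 1))) := by
        rw [abs_mul, Int.abs_fract]
        have := Int.fract_nonneg (x / N)
        gcongr
        exact (abs_sum_le_sum_abs _ _).trans (sum_le_sum h1)
      _ = C * logFactor x ^ A * x ^ (1 - s) * (∑ m ∈ Icc 1 ⌊x / N⌋₊, (m : ℝ) ^ (s - 1) +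
          Int.fract (x / N) * (x / N) ^ (s - 1)) := by
        rw [mul_add, mul_sum]
        congr 1
        · exact sum_congr rfl fun m _ => by ring
        · ring
      _ ≤ C * logFactor x ^ A * x ^ (1 - s) * ((x / N) ^ s / s) := by
        have := sum_rpow_sub_one_add_fract_le hs0 hs1 hM0
        gcongr
      _ = _ := by
        rw [Real.div_rpow hx0.le hN0.le, Real.rpow_neg hN0.le, Real.rpow_sub hx0, Real.rpow_one]
        have : x ^ s ≠ 0 := by positivity
        field_simp
  have hfract : |∑ n ∈ Icc 1 ⌊N⌋₊, (dk k n : ℝ) * Int.fract (x / n)| ≤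
      N * (logPoly k b (Real.log N) + C * logFactor N ^ A) := by
    have h1 : |∑ n ∈ Icc 1 ⌊N⌋₊, (dk k n : ℝ) * Int.fract (x / n)| ≤ Tk k N := by
      refine (abs_sum_le_sum_abs _ _).trans (sum_le_sum fun n _ => ?_)
      rw [abs_mul, Int.abs_fract, Nat.abs_cast]
      exact mul_le_of_le_one_right (by positivity) (Int.fract_lt_one _).le
    have h2 : Tk k N = N * logPoly k a (Real.log N) + remainder k a N := by simp [remainder]
    have h3 : logPoly k a (Real.log N) ≤ logPoly k b (Real.log N) :=
      (le_abs_self _).trans (abs_logPoly_le hab (abs_of_nonneg (Real.log_nonneg hN)).le)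
    have h4 : remainder k a N ≤ N * (C * logFactor N ^ A) := by
      refine (le_abs_self _).trans ((hrem N hN).trans ?_)
      have h5 : N ^ (1 - s) ≤ N := by
        simpa using Real.rpow_le_rpow_of_exponent_le hN (by linarith : 1 - s ≤ 1)
      have h6 : 0 ≤ logFactor N ^ A := Real.rpow_nonneg (by linarith) A
      calc _ ≤ C * N * logFactor N ^ A := by gcongr
        _ = _ := by ring
    calc _ ≤ Tk k N := h1
      _ ≤ N * logPoly k b (Real.log N) + N * (C * logFactor N ^ A) := by
        rw [h2]; gcongr
      _ = _ := by ring
  have htail : |x * ∫ t in Set.Ioi (x / N), Int.fract t * logPoly k (fun j => a j + a (j + 1))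
      (Real.log N - Real.log (t / (x / N))) / t ^ 2| ≤
      N * logPoly k (tailSum k fun j => b j + b (j + 1)) (Real.log N) := by
    have h1 := (integral_fract_mul_logPoly (k := k) (q := fun j => a j + a (j + 1))
      (b := fun j => b j + b (j + 1))
      (fun j => (abs_add_le _ _).trans (add_le_add (hab j) (hab (j + 1))))
      (fun j hj => by simp [hbk j hj, hbk (j + 1) (by omega)]) hM0 (Real.log_nonneg hN)).2
    rw [abs_mul, abs_of_pos hx0]
    calc _ ≤ x * (logPoly k (tailSum k fun j => b j + b (j + 1)) (Real.log N) / (x / N)) := by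
          gcongr
      _ = _ := by field_simp
  have hrest : |x * ∫ u in Set.Ioi N, remainder k a u / u ^ 2| ≤
      C * (1 / (s - A / 12)) * (x * N ^ (-s) * logFactor x ^ A) := by
    have h1 := (integral_remainder_bound hC hA hAs hrem hN).2
    have h2 : 0 < s - A / 12 := by linarith
    have h3 := Real.rpow_le_rpow (by linarith) hlamNx hA
    rw [abs_mul, abs_of_pos hx0]
    calc _ ≤ x * (C / (s - A / 12) * N ^ (-s) * logFactor x ^ A) := by
          gcongr
          exact h1.trans (by gcongr)
      _ = _ := by ring
  rw [remainder_nextCoeff ha h_integrable hN hx]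
  have hw : N * weight k b C A (Real.log N) =
      N * (logPoly k b (Real.log N) + C * logFactor N ^ A) +
      N * logPoly k (tailSum k fun j => b j + b (j + 1)) (Real.log N) := by
    rw [weight, logFactor]; ring
  rw [hw, mul_add C, add_mul]
  rw [abs_le] at *
  constructor <;> linarith [hsum.1, hsum.2, hfract.1, hfract.2, htail.1, htail.2, hrest.1, hrest.2]

lemma shiftUp_abs_le {a b : ℕ → ℝ} (hab : ∀ j, |a j| ≤ b j) (j : ℕ) :
    |shiftUp a j| ≤ shiftUp b j := by
  cases j with
  | zero => simp [shiftUp]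
  | succ j => exact hab j

lemma abs_nextCoeff_le {k : ℕ} {a b : ℕ → ℝ} {C A s : ℝ}
    (hab : ∀ j, |a j| ≤ b j) (hbk : ∀ j, k ≤ j → b j = 0) (hC : 0 ≤ C) (hA : 0 ≤ A)
    (hAs : A / 12 < s)
    (hrem : ∀ u, 1 ≤ u → |remainder k a u| ≤ C * u ^ (1 - s) * logFactor u ^ A) (j : ℕ) :
    |nextCoeff k a j| ≤ b j + shiftUp b j + tailSum k (fun i => b i + b (i + 1)) j +
      if j = 0 then C / (s - A / 12) else 0 := by
  have h1 := (integral_remainder_bound hC hA hAs hrem le_rfl).2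
  simp only [Real.one_rpow, logFactor, Real.log_one, zero_div, add_zero, mul_one] at h1
  have h2 := abs_fractCoeff_le (k := k) (q := fun j => a j + a (j + 1))
    (b := fun j => b j + b (j + 1))
    (fun j => (abs_add_le _ _).trans (add_le_add (hab j) (hab (j + 1))))
    (fun j hj => by simp [hbk j hj, hbk (j + 1) (by omega)]) j
  have h3 := shiftUp_abs_le hab j
  have h4 := hab j
  unfold nextCoeff
  refine (abs_add_le _ _).trans (add_le_add ((abs_sub _ _).trans
    (add_le_add ((abs_add_le _ _).trans (add_le_add h4 h3)) h2)) ?_)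
  split_ifs
  · exact h1
  · simp

lemma nextCoeff_self {k : ℕ} {a : ℕ → ℝ} (ha : ∀ j, k + 1 ≤ j → a j = 0) :
    nextCoeff (k + 1) a (k + 1) = a k := by
  have hq : ∀ j, k + 1 ≤ j → (fun i => a i + a (i + 1)) j = 0 := fun j hj => by
    simp [ha j hj, ha (j + 1) (by omega)]
  simp [nextCoeff, shiftUp, fractCoeff_of_le hq le_rfl, ha (k + 1) le_rfl]

/-- The asymptotic formula for `Tk (k + 1)`, with coefficients bounded by `b` and error bounded by
`C * u ^ (1 - s) * logFactor u ^ A`. -/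
def TkBound (k : ℕ) (b : ℕ → ℝ) (C A s : ℝ) : Prop :=
  ∃ a : ℕ → ℝ, a k = 1 ∧ (∀ j, |a j| ≤ b j) ∧
    ∀ u, 1 ≤ u → |remainder (k + 1) a u| ≤ C * u ^ (1 - s) * logFactor u ^ A

lemma TkBound.succ {k : ℕ} {b b' : ℕ → ℝ} {C A s C' A' s' B c : ℝ} (h : TkBound k b C A s)
    (hbk : ∀ j, k + 1 ≤ j → b j = 0) (hC : 0 ≤ C) (hA : 0 ≤ A) (hs1 : s ≤ 1) (hAs : A / 12 < s)
    (hs' : s' * (1 + s) = s) (hB : 0 ≤ B) (hBs : B / 12 ≤ 1 - s') (hA' : A + B * s = A')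
    (hB' : A' + B = k)
    (hb' : ∀ j, b j + shiftUp b j + tailSum (k + 1) (fun i => b i + b (i + 1)) j +
      (if j = 0 then C / (s - A / 12) else 0) ≤ b' j)
    (hw : ∀ y, 0 ≤ y → weight (k + 1) b C A y ≤ c * (1 + y / 12) ^ k)
    (hC' : C * (1 / s + 1 / (s - A / 12)) + c ≤ C') :
    TkBound (k + 1) b' C' A' s' := by
  obtain ⟨a, ha1, hab, hrem⟩ := h
  have ha : ∀ j, k + 1 ≤ j → a j = 0 := fun j hj => abs_nonpos_iff.1 ((hab j).trans (hbk j hj).le)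
  have hs0 : 0 < s := lt_of_le_of_lt (by positivity) hAs
  have hs'0 : 0 ≤ s' := nonneg_of_mul_nonneg_left (hs'.symm ▸ hs0.le) (by linarith)
  have hc : 0 ≤ c := by
    have hb : ∀ j, 0 ≤ b j := fun j => (abs_nonneg _).trans (hab j)
    have h1 : 0 ≤ weight (k + 1) b C A 0 := by
      have h2 := logPoly_nonneg (k := k + 1) hb le_rfl
      have h3 := logPoly_nonneg (k := k + 1)
        (tailSum_nonneg (k := k + 1) fun j => add_nonneg (hb j) (hb (j + 1))) le_rfl
      unfold weight
      positivity
    have h4 := h1.trans (hw 0 le_rfl)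
    simpa using h4
  refine ⟨nextCoeff (k + 1) a, by rw [nextCoeff_self ha, ha1], fun j =>
    (abs_nextCoeff_le hab hbk hC hA hAs hrem j).trans (hb' j), fun x hx => ?_⟩
  have hx0 : 0 < x := by linarith
  have hlam := one_le_logFactor hx
  have hlam0 : 0 < logFactor x := by linarith
  set N := x ^ (1 - s') * logFactor x ^ (-B) with hN
  have hN1 : 1 ≤ N := by
    have h1 : logFactor x ^ B ≤ x ^ (1 - s') := by
      calc logFactor x ^ B ≤ (x ^ ((1 : ℝ) / 12)) ^ B :=
            Real.rpow_le_rpow hlam0.le (logFactor_le_rpow hx) hB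
        _ = x ^ (B / 12) := by rw [← Real.rpow_mul hx0.le, one_div_mul_eq_div]
        _ ≤ _ := Real.rpow_le_rpow_of_exponent_le hx hBs
    rw [hN, Real.rpow_neg hlam0.le, ← div_eq_mul_inv]
    exact (one_le_div (by positivity)).2 h1
  have hNx : N ≤ x := by
    have h1 : x ^ (1 - s') ≤ x := by
      simpa using Real.rpow_le_rpow_of_exponent_le hx (by linarith : 1 - s' ≤ 1)
    have h2 : logFactor x ^ (-B) ≤ 1 := Real.rpow_le_one_of_one_le_of_nonpos hlam (by linarith)
    calc N ≤ x * 1 := by rw [hN]; gcongr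
      _ = x := mul_one x
  have hmain := abs_remainder_nextCoeff_le hab hbk hC hA hs1 hAs hrem hN1 hNx
  have h1 : x * N ^ (-s) * logFactor x ^ A = x ^ (1 - s') * logFactor x ^ A' := by
    rw [hN, Real.mul_rpow (by positivity) (by positivity), ← Real.rpow_mul hx0.le,
      ← Real.rpow_mul hlam0.le, show (1 - s') * -s = -s' by linear_combination hs',
      show -B * -s = B * s by ring, sub_eq_add_neg, Real.rpow_add hx0, Real.rpow_one, ← hA',
      Real.rpow_add hlam0]
    ring
  have h2 : N * weight (k + 1) b C A (Real.log N) ≤ c * (x ^ (1 - s') * logFactor x ^ A') := by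
    have h3 := hw _ (Real.log_nonneg hN1)
    have h4 : (1 + Real.log N / 12) ^ k ≤ logFactor x ^ k := by
      have := logFactor_mono hN1 hNx
      have := one_le_logFactor hN1
      exact pow_le_pow_left₀ (by unfold logFactor at *; linarith) (by assumption) k
    have h5 : logFactor x ^ A' = logFactor x ^ (-B) * logFactor x ^ k := by
      rw [← Real.rpow_natCast, ← Real.rpow_add hlam0, ← hB']
      congr 1
      ring
    calc _ ≤ N * (c * logFactor x ^ k) := by
          have := h3.trans (mul_le_mul_of_nonneg_left h4 hc)
          gcongr
      _ = _ := by rw [h5, hN]; ring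
  rw [h1] at hmain
  calc _ ≤ (C * (1 / s + 1 / (s - A / 12)) + c) * (x ^ (1 - s') * logFactor x ^ A') := by
        linarith
    _ ≤ C' * (x ^ (1 - s') * logFactor x ^ A') := by gcongr
    _ = _ := by ring

lemma tkBound_zero : TkBound 0 (fun j => [1].getD j 0) 1 0 1 := by
  refine ⟨fun j => [1].getD j 0, by simp, fun j => ?_, fun u hu => ?_⟩
  · rcases j with _ | j <;> simp
  · have h1 := Int.fract_nonneg u
    have h2 := (Int.fract_lt_one u).le
    have h3 : remainder (0 + 1) (fun j => [1].getD j 0) u = -Int.fract u := by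
      rw [remainder, Tk_one, natCast_floor_eq_sub_fract (by linarith)]
      simp [logPoly, -Int.self_sub_fract]
    rw [h3]
    simpa [abs_of_nonneg h1] using h2

lemma weight_le {k : ℕ} {b : ℕ → ℝ} {C A : ℝ} (hC : 0 ≤ C) (n : ℕ) (hA : A ≤ n) {y : ℝ}
    (hy : 0 ≤ y) : weight k b C A y ≤
      logPoly k b y + C * (1 + y / 12) ^ n + logPoly k (tailSum k fun j => b j + b (j + 1)) y := by
  have h : (1 + y / 12) ^ A ≤ (1 + y / 12) ^ n := by
    rw [← Real.rpow_natCast]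
    exact Real.rpow_le_rpow_of_exponent_le (by linarith) hA
  unfold weight
  gcongr

lemma tkBound_one : TkBound 1 (fun j => [3, 1].getD j 0) 5 0 (1 / 2) := by
  refine tkBound_zero.succ (B := 0) (c := 3) ?_ ?_ ?_ ?_ ?_ ?_ ?_ ?_ ?_ ?_ ?_ ?_ ?_ <;> try norm_num
  · intro j hj
    rcases j with _ | j <;> simp at *
  · intro j
    rcases j with _ | _ | j <;> norm_num [shiftUp, tailSum]
  · intro y hy
    norm_num [weight, logPoly, tailSum]

lemma tkBound_two : TkBound 2 (fun j => [18, 5, 1].getD j 0) 44 (1 / 3) (1 / 3) := by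
  refine tkBound_one.succ (B := 2 / 3) (c := 24) ?_ ?_ ?_ ?_ ?_ ?_ ?_ ?_ ?_ ?_ ?_ ?_ ?_ <;>
    try norm_num
  · intro j hj
    rcases j with _ | _ | j <;> simp at *
  · intro j
    rcases j with _ | _ | _ | j
    iterate 3 norm_num [shiftUp, tailSum, Finset.sum_Ico_succ_top, sum_range_succ]
    · simp [shiftUp, tailSum_of_le]
  · intro y hy
    refine (weight_le (by norm_num) 0 (by norm_num) hy).trans ?_
    norm_num [logPoly, tailSum, Finset.sum_Ico_succ_top, sum_range_succ, Nat.factorial]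
    nlinarith

lemma tkBound_three : TkBound 3 (fun j => [192, 30, 7, 1].getD j 0) 420 (3 / 4) (1 / 4) := by
  refine tkBound_two.succ (B := 5 / 4) (c := 144) ?_ ?_ ?_ ?_ ?_ ?_ ?_ ?_ ?_ ?_ ?_ ?_ ?_ <;>
    try norm_num
  · intro j hj
    rcases j with _ | _ | _ | j <;> simp at *
  · intro j
    rcases j with _ | _ | _ | _ | j
    iterate 4 norm_num [shiftUp, tailSum, Finset.sum_Ico_succ_top, sum_range_succ]
    · simp [shiftUp, tailSum_of_le]
  · intro y hy
    refine (weight_le (by norm_num) 1 (by norm_num) hy).trans ?_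
    norm_num [logPoly, tailSum, Finset.sum_Ico_succ_top, sum_range_succ, Nat.factorial]
    nlinarith

lemma tkBound_four : TkBound 4 (fun j => [2700, 268, 46, 9, 1].getD j 0) 4800 (6 / 5) (1 / 5) := by
  refine tkBound_three.succ (B := 9 / 5) (c := 880) ?_ ?_ ?_ ?_ ?_ ?_ ?_ ?_ ?_ ?_ ?_ ?_ ?_ <;>
    try norm_num
  · intro j hj
    rcases j with _ | _ | _ | _ | j <;> simp at *
  · intro j
    rcases j with _ | _ | _ | _ | _ | j
    iterate 5 norm_num [shiftUp, tailSum, Finset.sum_Ico_succ_top, sum_range_succ]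
    · simp [shiftUp, tailSum_of_le]
  · intro y hy
    refine (weight_le (by norm_num) 1 (by norm_num) hy).trans ?_
    norm_num [logPoly, tailSum, Finset.sum_Ico_succ_top, sum_range_succ, Nat.factorial]
    nlinarith [pow_nonneg hy 2, pow_nonneg hy 3]

lemma weight_five_le {y L : ℝ} (hy : 0 ≤ y) (hyL : y ≤ L) (hL : 93 ≤ L) :
    weight 5 (fun j => [2700, 268, 46, 9, 1].getD j 0) 4800 (6 / 5) y ≤ 2 / 5 * L ^ 4 := by
  refine (weight_le (by norm_num) 2 (by norm_num) hy).trans ?_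
  norm_num [logPoly, tailSum, Finset.sum_Ico_succ_top, sum_range_succ, Nat.factorial]
  have h2 : y ^ 2 ≤ L ^ 2 := by gcongr
  have h3 : y ^ 3 ≤ L ^ 3 := by gcongr
  have h4 : y ^ 4 ≤ L ^ 4 := by gcongr
  have h5 : 93 * L ≤ L ^ 2 := by nlinarith
  have h6 : 93 * L ^ 2 ≤ L ^ 3 := by nlinarith [sq_nonneg L]
  have h7 : 93 * L ^ 3 ≤ L ^ 4 := by nlinarith [pow_pos (by linarith : 0 < L) 3]
  nlinarith

lemma logFactor_rpow_le {x : ℝ} (hL : 93 ≤ Real.log x) :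
    logFactor x ^ ((6 : ℝ) / 5) ≤ Real.log x ^ ((6 : ℝ) / 5) / 16 := by
  have h1 : logFactor x ≤ 0.0941 * Real.log x := by unfold logFactor; linarith
  have h2 : (0 : ℝ) ≤ logFactor x := by unfold logFactor; linarith
  have h3 : (0.0941 : ℝ) ^ ((6 : ℝ) / 5) ≤ 1 / 16 := by
    have h4 : (1 / 16 : ℝ) = ((1 / 16) ^ 5) ^ ((1 : ℝ) / 5) := by
      rw [← Real.rpow_natCast, ← Real.rpow_mul (by norm_num)]
      norm_num
    have h5 : (0.0941 : ℝ) ^ ((6 : ℝ) / 5) = (0.0941 ^ 6) ^ ((1 : ℝ) / 5) := by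
      rw [← Real.rpow_natCast, ← Real.rpow_mul (by norm_num)]
      norm_num
    rw [h4, h5]
    exact Real.rpow_le_rpow (by norm_num) (by norm_num) (by norm_num)
  calc _ ≤ (0.0941 * Real.log x) ^ ((6 : ℝ) / 5) := Real.rpow_le_rpow h2 h1 (by norm_num)
    _ = 0.0941 ^ ((6 : ℝ) / 5) * Real.log x ^ ((6 : ℝ) / 5) :=
      Real.mul_rpow (by norm_num) (by linarith)
    _ ≤ 1 / 16 * Real.log x ^ ((6 : ℝ) / 5) := by gcongr
    _ = _ := by ring

lemma abs_remainder_six_lt {a : ℕ → ℝ} (hab : ∀ j, |a j| ≤ [2700, 268, 46, 9, 1].getD j 0)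
    (hrem : ∀ u, 1 ≤ u →
      |remainder 5 a u| ≤ 4800 * u ^ (1 - 1 / 5 : ℝ) * logFactor u ^ (6 / 5 : ℝ))
    {x : ℝ} (hx : Real.exp 93 ≤ x) :
    |remainder 6 (nextCoeff 5 a) x| <
      1576.988 * x ^ ((5 : ℝ) / 6) * Real.log x ^ ((5 : ℝ) / 3) := by
  have hL : 93 ≤ Real.log x := (Real.le_log_iff_exp_le ((Real.exp_pos _).trans_le hx)).2 hx
  have hx1 : 1 ≤ x := (Real.one_le_exp (by norm_num)).trans hx
  have hx0 : 0 < x := by linarith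
  have hlam := logFactor_rpow_le hL
  have hlogx : Real.log x ≤ 16 * x ^ ((1 : ℝ) / 12) := by
    have h1 := logFactor_le_rpow hx1
    unfold logFactor at h1
    linarith
  set L := Real.log x with hLdef
  have hL0 : 0 < L := by linarith
  set N := 1024 * (x ^ ((5 : ℝ) / 6) * L ^ (-(7 : ℝ) / 3)) with hN
  have hN1 : 1 ≤ N := by
    have h1 : L ^ ((7 : ℝ) / 3) ≤ 1024 * x ^ ((5 : ℝ) / 6) := by
      calc L ^ ((7 : ℝ) / 3) ≤ L ^ ((5 : ℝ) / 2) :=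
            Real.rpow_le_rpow_of_exponent_le (by linarith) (by norm_num)
        _ ≤ (16 * x ^ ((1 : ℝ) / 12)) ^ ((5 : ℝ) / 2) :=
            Real.rpow_le_rpow hL0.le hlogx (by norm_num)
        _ = 1024 * x ^ ((5 : ℝ) / 24) := by
            rw [Real.mul_rpow (by norm_num) (by positivity), ← Real.rpow_mul hx0.le,
              show (16 : ℝ) = 4 ^ (2 : ℝ) by norm_num, ← Real.rpow_mul (by norm_num)]
            norm_num
        _ ≤ _ := by
            have := Real.rpow_le_rpow_of_exponent_le hx1 (by norm_num : (5 : ℝ) / 24 ≤ 5 / 6)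
            gcongr
    rw [hN, neg_div, Real.rpow_neg hL0.le, ← mul_assoc, ← div_eq_mul_inv]
    exact (one_le_div (by positivity)).2 h1
  have hNx : N ≤ x := by
    have h1 : x ^ ((5 : ℝ) / 6) ≤ x := by
      simpa using Real.rpow_le_rpow_of_exponent_le hx1 (by norm_num : (5 : ℝ) / 6 ≤ 1)
    have h2 : 1024 ≤ L ^ ((7 : ℝ) / 3) := by
      calc (1024 : ℝ) ≤ L ^ (2 : ℝ) := by rw [Real.rpow_two]; nlinarith
        _ ≤ _ := Real.rpow_le_rpow_of_exponent_le (by linarith) (by norm_num)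
    rw [hN, neg_div, Real.rpow_neg hL0.le, ← mul_assoc, ← div_eq_mul_inv,
      div_le_iff₀ (by positivity)]
    nlinarith
  have hmain := abs_remainder_nextCoeff_le (k := 5) (s := 1 / 5) hab
    (fun j hj => by
      rcases j with _ | _ | _ | _ | _ | j <;> simp at *)
    (by norm_num) (by norm_num) (by norm_num) (by norm_num) hrem hN1 hNx
  have hw := weight_five_le (Real.log_nonneg hN1) (Real.log_le_log (by linarith) hNx) hL
  have hNpow : N ^ (-(1 / 5) : ℝ) = 1 / 4 * (x ^ (-(1 : ℝ) / 6) * L ^ ((7 : ℝ) / 15)) := by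
    rw [hN, Real.mul_rpow (by norm_num) (by positivity),
      Real.mul_rpow (by positivity) (by positivity), ← Real.rpow_mul hx0.le,
      ← Real.rpow_mul hL0.le, show (1024 : ℝ) = 4 ^ (5 : ℝ) by norm_num,
      ← Real.rpow_mul (by norm_num)]
    norm_num
  have hfirst : x * N ^ (-(1 / 5) : ℝ) * logFactor x ^ ((6 : ℝ) / 5) ≤
      1 / 64 * (x ^ ((5 : ℝ) / 6) * L ^ ((5 : ℝ) / 3)) := by
    have h1 : x ^ ((5 : ℝ) / 6) = x * x ^ (-(1 : ℝ) / 6) := by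
      rw [← Real.rpow_one_add' hx0.le (by norm_num)]
      norm_num
    have h2 : L ^ ((5 : ℝ) / 3) = L ^ ((7 : ℝ) / 15) * L ^ ((6 : ℝ) / 5) := by
      rw [← Real.rpow_add hL0]
      norm_num
    rw [hNpow, h1, h2]
    calc _ ≤ x * (1 / 4 * (x ^ (-(1 : ℝ) / 6) * L ^ ((7 : ℝ) / 15))) *
          (L ^ ((6 : ℝ) / 5) / 16) := by gcongr
      _ = _ := by ring
  have hsecond : N * weight 5 (fun j => [2700, 268, 46, 9, 1].getD j 0) 4800 (6 / 5) (Real.log N) ≤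
      2048 / 5 * (x ^ ((5 : ℝ) / 6) * L ^ ((5 : ℝ) / 3)) := by
    have h1 : L ^ ((5 : ℝ) / 3) = L ^ (-(7 : ℝ) / 3) * L ^ 4 := by
      rw [← Real.rpow_natCast, ← Real.rpow_add hL0]
      norm_num
    calc _ ≤ N * (2 / 5 * L ^ 4) := by gcongr
      _ = _ := by rw [h1, hN]; ring
  have hpos : 0 < x ^ ((5 : ℝ) / 6) * L ^ ((5 : ℝ) / 3) := by positivity
  norm_num at hmain hfirst hsecond hpos ⊢
  linarith

theorem stmt_5 :
    ∃ P : Polynomial ℝ, P.natDegree ≤ 5 ∧ P.coeff 5 = 1 / 120 ∧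
      ∀ x : ℝ, Real.exp 93 ≤ x →
        |Tk 6 x - x * P.eval (Real.log x)|
          < 1576.988 * x ^ ((5 : ℝ) / 6) * Real.log x ^ ((5 : ℝ) / 3) := by
  obtain ⟨a, ha1, hab, hrem⟩ := tkBound_four
  have ha : ∀ j, 5 ≤ j → a j = 0 := fun j hj => abs_nonpos_iff.1 ((hab j).trans (by
    rcases j with _ | _ | _ | _ | _ | j <;> simp at *))
  refine ⟨∑ j ∈ range 6, Polynomial.C (nextCoeff 5 a j / j.factorial) * Polynomial.X ^ j,
    ?_, ?_, fun x hx => ?_⟩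
  · refine Polynomial.natDegree_sum_le_of_forall_le _ _ fun j hj => ?_
    exact (Polynomial.natDegree_C_mul_X_pow_le _ _).trans (by have := mem_range.1 hj; omega)
  · have h : nextCoeff 5 a 5 = 1 := (nextCoeff_self ha).trans ha1
    simp [Polynomial.finsetSum_coeff, h, Nat.factorial]
  · have h := abs_remainder_six_lt hab hrem hx
    have h2 : logPoly 6 (nextCoeff 5 a) (Real.log x) = Polynomial.eval (Real.log x)
        (∑ j ∈ range 6, Polynomial.C (nextCoeff 5 a j / j.factorial) * Polynomial.X ^ j) := by
      rw [Polynomial.eval_finsetSum]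
      refine sum_congr rfl fun j _ => ?_
      simp only [Polynomial.eval_mul, Polynomial.eval_C, Polynomial.eval_pow, Polynomial.eval_X]
      ring
    rwa [remainder, h2] at h
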